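/- arXiv:1909.05844 — 2 statements merged into one kernel-verified Lean document; each statement's English description precedes it below -/
import Mathlib

section
/- Operator-norm bound for the averaged preconditioner (key step in the quadratic DANE rate). Let H_1, …, H_n be symmetric d×d real matrices with σ I_d ⪯ H_i ⪯ L I_d for all i, where 0 < σ ≤ L; set H̄ = (1/n)∑_{i=1}^n H_i and β = max_i ‖H_i − H̄‖. Suppose μ ≥ 0 and β < σ + μ. Then ‖ I_d − (1/n)∑_{i=1}^n (H_i + μ I_d)^{−1} H̄ ‖ ≤ 1 − σ/(σ + μ) + (L/(L + μ)) · β²/((σ + μ)(σ + μ − β)). -/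
open Finset Matrix

noncomputable section

/-- Spectral (ℓ₂ operator) norm of a square real matrix. -/
def specNorm {m : Type*} [Fintype m] [DecidableEq m] (A : Matrix m m ℝ) : ℝ :=
  ‖Matrix.toEuclideanCLM (𝕜 := ℝ) A‖

open scoped RealInnerProductSpace

/-- A positive operator with quadratic form at most `L‖x‖²` satisfies `T² ≤ L T`. -/
theorem ContinuousLinearMap.IsPositive.norm_apply_sq_le {E : Type*} [NormedAddCommGroup E]
    [InnerProductSpace ℝ E] {T : E →L[ℝ] E} (hT : T.IsPositive) {L : ℝ} (hL : 0 < L)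
    (hTL : ∀ x, ⟪T x, x⟫ ≤ L * ‖x‖ ^ 2) (x : E) : ‖T x‖ ^ 2 ≤ L * ⟪T x, x⟫ := by
  have h := hT.inner_nonneg_left (L • x - T x)
  have hsymm : ⟪T (T x), x⟫ = ‖T x‖ ^ 2 := by
    rw [hT.inner_left_eq_inner_right, real_inner_self_eq_norm_sq]
  simp only [map_sub, map_smul, inner_sub_left, inner_sub_right, real_inner_smul_left,
    real_inner_smul_right, hsymm, real_inner_self_eq_norm_sq] at h
  nlinarith [hTL (T x)]

theorem posSemidef_of_sub_smul_one {m : Type*} [DecidableEq m] {A : Matrix m m ℝ} {c : ℝ}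
    (hc : 0 ≤ c) (hA : (A - c • (1 : Matrix m m ℝ)).PosSemidef) : A.PosSemidef := by
  simpa using hA.add (PosSemidef.one.smul hc)

section

variable {m : Type*} [Fintype m] [DecidableEq m]

theorem specNorm_sub_le (A B : Matrix m m ℝ) : specNorm (A - B) ≤ specNorm A + specNorm B := by
  simpa [specNorm] using norm_sub_le (toEuclideanCLM (𝕜 := ℝ) A) (toEuclideanCLM (𝕜 := ℝ) B)

theorem specNorm_smul (c : ℝ) (A : Matrix m m ℝ) : specNorm (c • A) = |c| * specNorm A := by
  simp [specNorm, norm_smul]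

theorem specNorm_mul_le_of_le {A B : Matrix m m ℝ} {a b : ℝ} (hA : specNorm A ≤ a)
    (hB : specNorm B ≤ b) : specNorm (A * B) ≤ a * b := by
  unfold specNorm at *
  rw [map_mul]
  exact norm_mul_le_of_le hA hB

theorem specNorm_inv_smul_sum_le {n : ℕ} (hn : 0 < n) (A : Fin n → Matrix m m ℝ) {c : ℝ}
    (hA : ∀ i, specNorm (A i) ≤ c) : specNorm ((n : ℝ)⁻¹ • ∑ i, A i) ≤ c := by
  have hn' : (0 : ℝ) < n := by exact_mod_cast hn
  have h : specNorm (∑ i, A i) ≤ n * c := by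
    rw [specNorm, map_sum]
    simpa using norm_sum_le_of_le Finset.univ fun i _ => hA i
  rw [specNorm_smul, abs_of_pos (by positivity), inv_mul_le_iff₀ hn']
  exact h

theorem Matrix.PosSemidef.isPositive_toEuclideanCLM {A : Matrix m m ℝ} (hA : A.PosSemidef) :
    (toEuclideanCLM (𝕜 := ℝ) A).IsPositive := by
  rw [← ContinuousLinearMap.isPositive_toLinearMap_iff, coe_toEuclideanCLM_eq_toEuclideanLin]
  exact isPositive_toEuclideanLin_iff.2 hA

theorem isUnit_det_of_sub_smul_one {A : Matrix m m ℝ} {c : ℝ} (hc : 0 < c)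
    (hA : (A - c • (1 : Matrix m m ℝ)).PosSemidef) : IsUnit A.det := by
  have h : A.PosDef := by simpa using PosDef.posSemidef_add hA (PosDef.one.smul hc)
  exact h.det_pos.ne'.isUnit

/-- If `‖C x‖ ≤ c ‖A x‖` for all `x`, then `‖C A⁻¹‖ ≤ c`. -/
theorem specNorm_mul_inv_le {A C : Matrix m m ℝ} (hA : IsUnit A.det) {c : ℝ} (hc : 0 ≤ c)
    (h : ∀ x, ‖toEuclideanCLM (𝕜 := ℝ) C x‖ ≤ c * ‖toEuclideanCLM (𝕜 := ℝ) A x‖) :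
    specNorm (C * A⁻¹) ≤ c := by
  refine ContinuousLinearMap.opNorm_le_bound _ hc fun x => ?_
  have hx := h (toEuclideanCLM (𝕜 := ℝ) A⁻¹ x)
  rwa [← mul_apply_eq_comp, ← mul_apply_eq_comp, ← map_mul, ← map_mul,
    mul_nonsing_inv _ hA, map_one, one_apply_eq_self] at hx

theorem specNorm_inv_le {A : Matrix m m ℝ} {c : ℝ} (hc : 0 < c)
    (hA : (A - c • (1 : Matrix m m ℝ)).PosSemidef) : specNorm A⁻¹ ≤ c⁻¹ := by
  rw [← one_mul A⁻¹]
  refine specNorm_mul_inv_le (isUnit_det_of_sub_smul_one hc hA) (by positivity) fun x => ?_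
  have h := hA.isPositive_toEuclideanCLM.inner_nonneg_left x
  simp only [map_sub, map_smul, map_one, _root_.sub_apply,
    _root_.smul_apply, one_apply_eq_self, inner_sub_left,
    real_inner_smul_left, real_inner_self_eq_norm_sq] at h ⊢
  have hcs := real_inner_le_norm (toEuclideanCLM (𝕜 := ℝ) A x) x
  rw [le_inv_mul_iff₀ hc]
  rcases (norm_nonneg x).eq_or_lt with hx | hx
  · rw [← hx, mul_zero]
    positivity
  · exact le_of_mul_le_mul_right (by nlinarith) hx

theorem specNorm_inv_mul_le {A : Matrix m m ℝ} {L μ : ℝ} (hL : 0 < L) (hμ : 0 ≤ μ)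
    (hA : A.PosSemidef) (hAL : (L • (1 : Matrix m m ℝ) - A).PosSemidef)
    (hK : IsUnit (A + μ • 1).det) : specNorm ((A + μ • 1)⁻¹ * A) ≤ L / (L + μ) := by
  have hcomm : (A + μ • 1)⁻¹ * A = A * (A + μ • 1)⁻¹ := by
    have h₁ := nonsing_inv_mul _ hK
    have h₂ := mul_nonsing_inv _ hK
    rw [mul_add, mul_smul_comm, mul_one] at h₁
    rw [add_mul, smul_mul_assoc, one_mul] at h₂
    exact add_right_cancel (h₁.trans h₂.symm)
  rw [hcomm]
  refine specNorm_mul_inv_le hK (by positivity) fun x => ?_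
  have hTL : ∀ y, ⟪toEuclideanCLM (𝕜 := ℝ) A y, y⟫ ≤ L * ‖y‖ ^ 2 := fun y => by
    have h := hAL.isPositive_toEuclideanCLM.inner_nonneg_left y
    simp only [map_sub, map_smul, map_one, _root_.sub_apply,
      _root_.smul_apply, one_apply_eq_self, inner_sub_left,
      real_inner_smul_left, real_inner_self_eq_norm_sq] at h
    linarith
  have hsq := hA.isPositive_toEuclideanCLM.norm_apply_sq_le hL hTL x
  have hx := hTL x
  simp only [map_add, map_smul, map_one, _root_.add_apply,
    _root_.smul_apply, one_apply_eq_self]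
  set y := toEuclideanCLM (𝕜 := ℝ) A x
  have hexp : ‖y + μ • x‖ ^ 2 = ‖y‖ ^ 2 + 2 * μ * ⟪y, x⟫ + μ ^ 2 * ‖x‖ ^ 2 := by
    rw [norm_add_sq_real, real_inner_smul_right, norm_smul, mul_pow, Real.norm_eq_abs, sq_abs]
    ring
  have hsq' : ‖y‖ ^ 2 ≤ L ^ 2 * ‖x‖ ^ 2 := by nlinarith
  rw [div_mul_eq_mul_div, le_div_iff₀ (by positivity)]
  refine le_of_sq_le_sq ?_ (by positivity)
  rw [mul_pow, mul_pow, hexp]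
  nlinarith [mul_le_mul_of_nonneg_left hsq (by positivity : 0 ≤ 2 * L * μ),
    mul_le_mul_of_nonneg_left hsq' (sq_nonneg μ)]

/-- Second-order resolvent expansion of `B⁻¹` around `A⁻¹`. -/
theorem inv_eq_second_order {A B : Matrix m m ℝ} (hA : IsUnit A.det) (hB : IsUnit B.det) :
    B⁻¹ = A⁻¹ - A⁻¹ * (B - A) * A⁻¹ + B⁻¹ * (B - A) * A⁻¹ * (B - A) * A⁻¹ := by
  have h₁ : B⁻¹ * (B - A) * A⁻¹ = A⁻¹ - B⁻¹ := by
    rw [mul_sub, sub_mul, nonsing_inv_mul _ hB, one_mul, mul_assoc, mul_nonsing_inv _ hA, mul_one]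
  have h₂ : B⁻¹ * (B - A) * A⁻¹ * (B - A) * A⁻¹
      = A⁻¹ * (B - A) * A⁻¹ - B⁻¹ * (B - A) * A⁻¹ := by
    rw [h₁, sub_mul, sub_mul, h₁]
  rw [h₂, h₁]
  abel

end

/-- **Operator-norm bound for the averaged preconditioner.**  If `H₁, …, Hₙ` are
symmetric with `σ I ⪯ Hᵢ ⪯ L I` (`0 < σ ≤ L`), `H̄ = (1/n)∑ Hᵢ`,
`β = maxᵢ ‖Hᵢ − H̄‖`, `μ ≥ 0` and `β < σ + μ`, then
`‖I − (1/n)∑ (Hᵢ + μI)⁻¹ H̄‖ ≤ 1 − σ/(σ+μ) + (L/(L+μ))·β²/((σ+μ)(σ+μ−β))`. -/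
theorem averaged_preconditioner_bound
    {n d : ℕ} (hn : 0 < n) (σ L μ β : ℝ)
    (hσ : 0 < σ) (hσL : σ ≤ L) (hμ : 0 ≤ μ)
    (H : Fin n → Matrix (Fin d) (Fin d) ℝ)
    (hsymm : ∀ i, (H i).IsSymm)
    (hlow : ∀ i, (H i - σ • (1 : Matrix (Fin d) (Fin d) ℝ)).PosSemidef)
    (hup : ∀ i, (L • (1 : Matrix (Fin d) (Fin d) ℝ) - H i).PosSemidef)
    (Hbar : Matrix (Fin d) (Fin d) ℝ) (hHbar : Hbar = (n : ℝ)⁻¹ • ∑ i, H i)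
    (hβ : IsGreatest (Set.range fun i => specNorm (H i - Hbar)) β)
    (hβμ : β < σ + μ) :
    specNorm (1 - (n : ℝ)⁻¹ • ∑ i, (H i + μ • 1)⁻¹ * Hbar)
      ≤ 1 - σ / (σ + μ) + L / (L + μ) * (β ^ 2 / ((σ + μ) * (σ + μ - β))) := by
  have hβ_le : ∀ i, specNorm (H i - Hbar) ≤ β := fun i => hβ.2 ⟨i, rfl⟩
  have hβ_nonneg : 0 ≤ β := (norm_nonneg _).trans (hβ_le ⟨0, hn⟩)
  have hσμ : 0 < σ + μ := by linarith
  have hn_ne : (n : ℝ) ≠ 0 := by exact_mod_cast hn.ne'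
  have hlow_bar : (Hbar - σ • (1 : Matrix (Fin d) (Fin d) ℝ)).PosSemidef := by
    have h : Hbar - σ • (1 : Matrix (Fin d) (Fin d) ℝ)
        = (n : ℝ)⁻¹ • ∑ i, (H i - σ • (1 : Matrix (Fin d) (Fin d) ℝ)) := by
      rw [hHbar, Finset.sum_sub_distrib, smul_sub]
      simp [← Nat.cast_smul_eq_nsmul ℝ, smul_smul, hn_ne]
    rw [h]
    exact (posSemidef_sum _ fun i _ => hlow i).smul (by positivity)
  have hup_bar : (L • (1 : Matrix (Fin d) (Fin d) ℝ) - Hbar).PosSemidef := by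
    have h : L • (1 : Matrix (Fin d) (Fin d) ℝ) - Hbar
        = (n : ℝ)⁻¹ • ∑ i, (L • (1 : Matrix (Fin d) (Fin d) ℝ) - H i) := by
      rw [hHbar, Finset.sum_sub_distrib, smul_sub]
      simp [← Nat.cast_smul_eq_nsmul ℝ, smul_smul, hn_ne]
    rw [h]
    exact (posSemidef_sum _ fun i _ => hup i).smul (by positivity)
  have hbar_psd := posSemidef_of_sub_smul_one hσ.le hlow_bar
  have hsum : ∑ i, (H i - Hbar) = 0 := by
    rw [Finset.sum_sub_distrib, hHbar]
    simp [← Nat.cast_smul_eq_nsmul ℝ, smul_smul, hn_ne]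
  have hshift : ∀ {A : Matrix (Fin d) (Fin d) ℝ}, (A - σ • (1 : Matrix _ _ ℝ)).PosSemidef →
      (A + μ • 1 - (σ + μ) • (1 : Matrix _ _ ℝ)).PosSemidef := fun {A} hA => by
    convert hA using 1
    rw [add_smul]
    abel
  have hK := isUnit_det_of_sub_smul_one hσμ (hshift hlow_bar)
  have hKi := fun i => isUnit_det_of_sub_smul_one hσμ (hshift (hlow i))
  have hK_inv := specNorm_inv_le hσμ (hshift hlow_bar)
  have hKi_inv := fun i => specNorm_inv_le hσμ (hshift (hlow i))
  have hratio := specNorm_inv_mul_le (hσ.trans_le hσL) hμ hbar_psd hup_bar hK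
  have hcompl : 1 - (Hbar + μ • 1)⁻¹ * Hbar = μ • (Hbar + μ • 1)⁻¹ := by
    have h := nonsing_inv_mul _ hK
    rw [mul_add, mul_smul_comm, mul_one] at h
    exact sub_eq_of_eq_add' h.symm
  have hexpand : 1 - (n : ℝ)⁻¹ • ∑ i, (H i + μ • 1)⁻¹ * Hbar
      = μ • (Hbar + μ • 1)⁻¹ - ((n : ℝ)⁻¹ • ∑ i, (H i + μ • 1)⁻¹ * (H i - Hbar)
          * (Hbar + μ • 1)⁻¹ * (H i - Hbar)) * ((Hbar + μ • 1)⁻¹ * Hbar) := by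
    have h : ∀ i, (H i + μ • 1)⁻¹ * Hbar = (Hbar + μ • 1)⁻¹ * Hbar
        - (Hbar + μ • 1)⁻¹ * (H i - Hbar) * ((Hbar + μ • 1)⁻¹ * Hbar)
        + (H i + μ • 1)⁻¹ * (H i - Hbar) * (Hbar + μ • 1)⁻¹ * (H i - Hbar)
          * ((Hbar + μ • 1)⁻¹ * Hbar) := fun i => by
      conv_lhs => rw [inv_eq_second_order hK (hKi i), add_sub_add_right_eq_sub]
      noncomm_ring
    rw [Finset.sum_congr rfl fun i _ => h i, Finset.sum_add_distrib, Finset.sum_sub_distrib,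
      ← Finset.sum_mul, ← Finset.sum_mul, ← Finset.mul_sum, hsum, ← hcompl]
    simp [← Nat.cast_smul_eq_nsmul ℝ, smul_smul, hn_ne, sub_sub, Finset.sum_mul]
  have hterm : ∀ i, specNorm ((H i + μ • 1)⁻¹ * (H i - Hbar) * (Hbar + μ • 1)⁻¹ * (H i - Hbar))
      ≤ β ^ 2 / ((σ + μ) * (σ + μ - β)) := fun i => by
    calc _ ≤ (σ + μ)⁻¹ * β * (σ + μ)⁻¹ * β := by
          exact specNorm_mul_le_of_le (specNorm_mul_le_of_le (specNorm_mul_le_of_le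
            (hKi_inv i) (hβ_le i)) hK_inv) (hβ_le i)
      _ = β ^ 2 / ((σ + μ) * (σ + μ)) := by field_simp
      _ ≤ _ := by
          have : 0 < σ + μ - β := by linarith
          gcongr
          linarith
  have hmean := specNorm_inv_smul_sum_le hn _ hterm
  calc _ ≤ specNorm (μ • (Hbar + μ • 1)⁻¹) + specNorm (((n : ℝ)⁻¹ • ∑ i, (H i + μ • 1)⁻¹
          * (H i - Hbar) * (Hbar + μ • 1)⁻¹ * (H i - Hbar)) * ((Hbar + μ • 1)⁻¹ * Hbar)) := by
        rw [hexpand]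
        exact specNorm_sub_le _ _
    _ ≤ μ * (σ + μ)⁻¹ + β ^ 2 / ((σ + μ) * (σ + μ - β)) * (L / (L + μ)) := by
        refine add_le_add ?_ (specNorm_mul_le_of_le hmean hratio)
        rw [specNorm_smul, abs_of_nonneg hμ]
        gcongr
    _ = _ := by
        rw [mul_comm (β ^ 2 / _)]
        congr 1
        field_simp
        ring

end
end

section
/- One-step contraction of averaged DANE for a quadratic global loss. Let H_1, …, H_n be symmetric d×d real matrices with σ I_d ⪯ H_i ⪯ L I_d (0 < σ ≤ L), H̄ = (1/n)∑_i H_i, β = max_i ‖H_i − H̄‖, μ ≥ 0 with β < σ + μ. Let f(x) = (1/2)xᵀH̄x + bᵀx + c with minimizer y* (so ∇f(y*) = 0). For any ȳ ∈ ℝ^d define x̄⁺ = ȳ − (1/n)∑_{i=1}^n (H_i + μ I_d)^{−1} ∇f(ȳ). Then ‖x̄⁺ − y*‖ ≤ θ₁ ‖ȳ − y*‖, where θ₁ = 1 − σ/(σ+μ) + (L/(L+μ))·β²/((σ+μ)(σ+μ−β)). -/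
open Finset Matrix

noncomputable section

/-- Euclidean norm of a vector in `ℝ^d`. -/
def vecNorm {d : ℕ} (v : Fin d → ℝ) : ℝ := Real.sqrt (∑ i, v i ^ 2)

section L2Operator

open scoped Matrix.Norms.L2Operator RealInnerProductSpace

variable {m : Type*} [Fintype m] [DecidableEq m]

theorem Matrix.PosSemidef.inner_toEuclideanCLM_nonneg {A : Matrix m m ℝ} (hA : A.PosSemidef)
    (x : EuclideanSpace ℝ m) : 0 ≤ ⟪x, toEuclideanCLM (𝕜 := ℝ) A x⟫ := by
  rw [inner_toEuclideanCLM]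
  exact hA.dotProduct_mulVec_nonneg x

theorem Matrix.IsSymm.inner_toEuclideanCLM_left {A : Matrix m m ℝ} (hA : A.IsSymm)
    (x y : EuclideanSpace ℝ m) :
    ⟪toEuclideanCLM (𝕜 := ℝ) A x, y⟫ = ⟪x, toEuclideanCLM (𝕜 := ℝ) A y⟫ := by
  rw [real_inner_comm, inner_toEuclideanCLM, inner_toEuclideanCLM, dotProduct_mulVec,
    ← mulVec_transpose, hA.eq, dotProduct_comm]

theorem Matrix.isUnit_det_of_posSemidef_sub_smul_one {A : Matrix m m ℝ} {s : ℝ} (hs : 0 < s)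
    (hA : (A - s • (1 : Matrix m m ℝ)).PosSemidef) : IsUnit A.det := by
  have h : (A - s • (1 : Matrix m m ℝ) + s • 1).PosDef :=
    Matrix.PosDef.posSemidef_add hA (Matrix.PosDef.one.smul hs)
  rw [sub_add_cancel] at h
  exact h.det_pos.ne'.isUnit

theorem Matrix.mul_norm_le_norm_toEuclideanCLM {A : Matrix m m ℝ} {s : ℝ}
    (hA : (A - s • (1 : Matrix m m ℝ)).PosSemidef) (x : EuclideanSpace ℝ m) :
    s * ‖x‖ ≤ ‖toEuclideanCLM (𝕜 := ℝ) A x‖ := by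
  have h := hA.inner_toEuclideanCLM_nonneg x
  simp only [map_sub, map_smul, map_one, _root_.sub_apply, _root_.smul_apply,
    one_apply_eq_self, inner_sub_right, real_inner_smul_right,
    real_inner_self_eq_norm_sq] at h
  have h' := real_inner_le_norm x (toEuclideanCLM (𝕜 := ℝ) A x)
  rcases (norm_nonneg x).eq_or_lt with hx | hx
  · simp [← hx]
  · nlinarith

theorem Matrix.norm_inv_le_of_posSemidef_sub_smul_one {A : Matrix m m ℝ} {s : ℝ} (hs : 0 < s)
    (hA : (A - s • (1 : Matrix m m ℝ)).PosSemidef) : ‖A⁻¹‖ ≤ s⁻¹ := by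
  rw [← l2_opNorm_toEuclideanCLM]
  refine ContinuousLinearMap.opNorm_le_bound _ (by positivity) fun x => ?_
  have h := mul_norm_le_norm_toEuclideanCLM hA (toEuclideanCLM (𝕜 := ℝ) A⁻¹ x)
  rw [← mul_apply_eq_comp, ← map_mul,
    mul_nonsing_inv _ (isUnit_det_of_posSemidef_sub_smul_one hs hA), map_one,
    one_apply_eq_self] at h
  rwa [inv_mul_eq_div, le_div_iff₀' hs]

/-- Cocoercivity of a positive semidefinite matrix bounded above by `L`. -/
theorem Matrix.norm_sq_toEuclideanCLM_le {A : Matrix m m ℝ} {L : ℝ} (hL : 0 < L)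
    (hA : A.PosSemidef) (hAL : (L • (1 : Matrix m m ℝ) - A).PosSemidef)
    (x : EuclideanSpace ℝ m) :
    ‖toEuclideanCLM (𝕜 := ℝ) A x‖ ^ 2 ≤ L * ⟪x, toEuclideanCLM (𝕜 := ℝ) A x⟫ := by
  have hsymm : A.IsSymm := by simpa [Matrix.IsSymm, Matrix.IsHermitian] using hA.isHermitian
  set T := toEuclideanCLM (𝕜 := ℝ) A with hT
  have h₁ := hA.inner_toEuclideanCLM_nonneg (L • x - T x)
  have h₂ := hAL.inner_toEuclideanCLM_nonneg (T x)
  have h₃ := hsymm.inner_toEuclideanCLM_left x (T x)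
  simp only [map_sub, map_smul, map_one, _root_.sub_apply, _root_.smul_apply, ← hT,
    one_apply_eq_self, inner_sub_right, inner_sub_left, real_inner_smul_right,
    real_inner_smul_left, real_inner_self_eq_norm_sq] at h₁ h₂ h₃
  rw [← h₃] at h₁
  have h : 0 ≤ L * (L * ⟪x, T x⟫ - ‖T x‖ ^ 2) := by nlinarith
  exact sub_nonneg.1 (nonneg_of_mul_nonneg_right h hL)

theorem Matrix.norm_inv_add_smul_one_mul_le {A : Matrix m m ℝ} {s L μ : ℝ} (hs : 0 < s)
    (hL : 0 < L) (hμ : 0 ≤ μ) (hA : (A - s • (1 : Matrix m m ℝ)).PosSemidef)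
    (hAL : (L • (1 : Matrix m m ℝ) - A).PosSemidef) :
    ‖(A + μ • 1)⁻¹ * A‖ ≤ L / (L + μ) := by
  have hA₀ : A.PosSemidef := by simpa using hA.add (Matrix.PosSemidef.one.smul hs.le)
  rcases hμ.eq_or_lt with rfl | hμ
  · have hu := isUnit_det_of_posSemidef_sub_smul_one hs hA
    rw [zero_smul, add_zero, nonsing_inv_mul _ hu, add_zero, div_self hL.ne',
      ← l2_opNorm_toEuclideanCLM, map_one]
    exact ContinuousLinearMap.norm_id_le
  have hu : IsUnit (A + μ • 1).det := by
    refine isUnit_det_of_posSemidef_sub_smul_one hμ ?_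
    simpa using hA₀
  rw [← l2_opNorm_toEuclideanCLM]
  refine ContinuousLinearMap.opNorm_le_bound _ (by positivity) fun x => ?_
  set w := toEuclideanCLM (𝕜 := ℝ) ((A + μ • 1)⁻¹ * A) x with hw
  have hAw : toEuclideanCLM (𝕜 := ℝ) A (x - w) = μ • w := by
    have h : toEuclideanCLM (𝕜 := ℝ) (A + μ • 1) w = toEuclideanCLM (𝕜 := ℝ) A x := by
      rw [hw, ← mul_apply_eq_comp, ← map_mul, ← mul_assoc, mul_nonsing_inv _ hu,
        one_mul]
    simp only [map_add, map_smul, map_one, _root_.add_apply, _root_.smul_apply,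
      one_apply_eq_self] at h
    rw [map_sub, ← h, add_sub_cancel_left]
  have h := norm_sq_toEuclideanCLM_le hL hA₀ hAL (x - w)
  rw [hAw, norm_smul, Real.norm_of_nonneg hμ.le, real_inner_smul_right, inner_sub_left,
    real_inner_self_eq_norm_sq] at h
  have h' : μ * ‖w‖ ^ 2 ≤ L * (⟪x, w⟫ - ‖w‖ ^ 2) := by
    refine le_of_mul_le_mul_left ?_ hμ
    linarith
  have h'' := real_inner_le_norm x w
  rw [div_mul_eq_mul_div, le_div_iff₀ (by positivity)]
  rcases (norm_nonneg w).eq_or_lt with hw₀ | hw₀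
  · rw [← hw₀, zero_mul]
    positivity
  · refine le_of_mul_le_mul_right ?_ hw₀
    nlinarith

/-- Second-order expansion of the inverse of `K` around `M`. -/
theorem Matrix.inv_eq_second_order {K M : Matrix m m ℝ} (hK : IsUnit K.det) (hM : IsUnit M.det) :
    K⁻¹ = M⁻¹ - M⁻¹ * (K - M) * M⁻¹ + K⁻¹ * (K - M) * M⁻¹ * (K - M) * M⁻¹ := by
  have h₁ := nonsing_inv_mul K hK
  have h₂ := mul_nonsing_inv M hM
  have h : K⁻¹ * (K - M) * M⁻¹ = M⁻¹ - K⁻¹ := by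
    rw [mul_sub, sub_mul, h₁, one_mul, mul_assoc, h₂, mul_one]
  rw [h, sub_mul, sub_mul, h]
  abel

theorem Matrix.inv_average_eq {n : ℕ} (hn : 0 < n) {K : Fin n → Matrix m m ℝ} {M : Matrix m m ℝ}
    (hM : M = (n : ℝ)⁻¹ • ∑ i, K i) (hK : ∀ i, IsUnit (K i).det) (hMu : IsUnit M.det) :
    (n : ℝ)⁻¹ • ∑ i, (K i)⁻¹ =
      M⁻¹ + (n : ℝ)⁻¹ • ∑ i, (K i)⁻¹ * (K i - M) * M⁻¹ * (K i - M) * M⁻¹ := by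
  have hn' : (n : ℝ) ≠ 0 := by positivity
  have hsum : ∑ i, (K i - M) = 0 := by
    rw [Finset.sum_sub_distrib, Finset.sum_const, Finset.card_univ, Fintype.card_fin,
      ← Nat.cast_smul_eq_nsmul ℝ, hM, smul_inv_smul₀ hn', sub_self]
  rw [Finset.sum_congr rfl fun i _ => inv_eq_second_order (hK i) hMu, Finset.sum_add_distrib,
    Finset.sum_sub_distrib, ← Finset.sum_mul, ← Finset.mul_sum, hsum, mul_zero, zero_mul, sub_zero,
    smul_add, Finset.sum_const, Finset.card_univ, Fintype.card_fin, ← Nat.cast_smul_eq_nsmul ℝ,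
    inv_smul_smul₀ hn']

theorem Matrix.norm_one_sub_average_inv_mul_le {n : ℕ} (hn : 0 < n) {σ L μ β : ℝ} (hσ : 0 < σ)
    (hL : 0 < L) (hμ : 0 ≤ μ) (hβ₀ : 0 ≤ β) {H : Fin n → Matrix m m ℝ}
    (hlow : ∀ i, (H i - σ • (1 : Matrix m m ℝ)).PosSemidef)
    (hup : ∀ i, (L • (1 : Matrix m m ℝ) - H i).PosSemidef)
    {Hbar : Matrix m m ℝ} (hHbar : Hbar = (n : ℝ)⁻¹ • ∑ i, H i)
    (hβ : ∀ i, ‖H i - Hbar‖ ≤ β) :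
    ‖1 - ((n : ℝ)⁻¹ • ∑ i, (H i + μ • 1)⁻¹) * Hbar‖ ≤
      μ / (σ + μ) + L / (L + μ) * (β ^ 2 / (σ + μ) ^ 2) := by
  have hn' : (n : ℝ) ≠ 0 := by positivity
  have average_const (A : Matrix m m ℝ) : (n : ℝ)⁻¹ • ∑ _i : Fin n, A = A := by
    rw [Finset.sum_const, Finset.card_univ, Fintype.card_fin, ← Nat.cast_smul_eq_nsmul ℝ,
      inv_smul_smul₀ hn']
  have hn₀ : (0 : ℝ) ≤ (n : ℝ)⁻¹ := by positivity
  have hblow : (Hbar - σ • (1 : Matrix m m ℝ)).PosSemidef := by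
    have h := (Matrix.posSemidef_sum Finset.univ fun i _ => hlow i).smul hn₀
    rwa [Finset.sum_sub_distrib, smul_sub, average_const, ← hHbar] at h
  have hbup : (L • (1 : Matrix m m ℝ) - Hbar).PosSemidef := by
    have h := (Matrix.posSemidef_sum Finset.univ fun i _ => hup i).smul hn₀
    rwa [Finset.sum_sub_distrib, smul_sub, average_const, ← hHbar] at h
  have hs : 0 < σ + μ := by positivity
  have shift {A : Matrix m m ℝ} (hA : (A - σ • (1 : Matrix m m ℝ)).PosSemidef) :
      (A + μ • 1 - (σ + μ) • (1 : Matrix m m ℝ)).PosSemidef := by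
    rwa [add_smul, add_sub_add_right_eq_sub]
  set M := Hbar + μ • (1 : Matrix m m ℝ) with hM
  have hMu : IsUnit M.det := isUnit_det_of_posSemidef_sub_smul_one hs (shift hblow)
  have hMavg : M = (n : ℝ)⁻¹ • ∑ i, (H i + μ • 1) := by
    rw [Finset.sum_add_distrib, smul_add, average_const, ← hHbar]
  have hMinv : ‖M⁻¹‖ ≤ (σ + μ)⁻¹ := norm_inv_le_of_posSemidef_sub_smul_one hs (shift hblow)
  have hMH : ‖M⁻¹ * Hbar‖ ≤ L / (L + μ) := norm_inv_add_smul_one_mul_le hσ hL hμ hblow hbup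
  have hone : 1 - M⁻¹ * Hbar = μ • M⁻¹ := by
    rw [← nonsing_inv_mul M hMu, ← mul_sub, hM, add_sub_cancel_left, mul_smul_comm, mul_one]
  have hterm (i : Fin n) :
      ‖(H i + μ • 1)⁻¹ * (H i - Hbar) * M⁻¹ * (H i - Hbar) * M⁻¹ * Hbar‖ ≤
        L / (L + μ) * (β ^ 2 / (σ + μ) ^ 2) := by
    have hK := norm_inv_le_of_posSemidef_sub_smul_one hs (shift (hlow i))
    rw [mul_assoc _ M⁻¹ Hbar]
    calc _ ≤ ‖(H i + μ • 1)⁻¹‖ * ‖H i - Hbar‖ * ‖M⁻¹‖ * ‖H i - Hbar‖ * ‖M⁻¹ * Hbar‖ := by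
          refine (norm_mul_le _ _).trans ?_
          gcongr
          refine (norm_mul_le _ _).trans ?_
          gcongr
          refine (norm_mul_le _ _).trans ?_
          gcongr
          exact norm_mul_le _ _
      _ ≤ (σ + μ)⁻¹ * β * (σ + μ)⁻¹ * β * (L / (L + μ)) := by
          gcongr
          exacts [hβ i, hβ i]
      _ = _ := by field_simp
  rw [inv_average_eq hn hMavg (fun i => isUnit_det_of_posSemidef_sub_smul_one hs (shift (hlow i)))
    hMu, add_mul, ← sub_sub, hone, smul_mul_assoc, Finset.sum_mul]
  simp only [hM, add_sub_add_right_eq_sub]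
  rw [← hM]
  refine (norm_sub_le _ _).trans (add_le_add ?_ ?_)
  · rw [norm_smul, Real.norm_of_nonneg hμ, div_eq_mul_inv]
    gcongr
  · rw [norm_smul, Real.norm_of_nonneg hn₀, inv_mul_le_iff₀ (by positivity)]
    refine (norm_sum_le_of_le _ fun i _ => hterm i).trans_eq ?_
    simp

end L2Operator

theorem vecNorm_eq_norm_toLp {d : ℕ} (v : Fin d → ℝ) : vecNorm v = ‖WithLp.toLp 2 v‖ := by
  simp [vecNorm, EuclideanSpace.norm_eq]

theorem vecNorm_mulVec_le {d : ℕ} (A : Matrix (Fin d) (Fin d) ℝ) (v : Fin d → ℝ) :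
    vecNorm (A.mulVec v) ≤ specNorm A * vecNorm v := by
  rw [vecNorm_eq_norm_toLp, vecNorm_eq_norm_toLp, ← toEuclideanCLM_toLp]
  exact ContinuousLinearMap.le_opNorm _ _

/-- **One-step contraction of averaged DANE for a quadratic global loss.**  With
`σ I ⪯ Hᵢ ⪯ L I`, `H̄ = (1/n)∑ Hᵢ`, `β = maxᵢ ‖Hᵢ − H̄‖ < σ + μ`, global quadratic loss
`f(x) = ½ xᵀH̄x + bᵀx + c` with minimizer `y*` (so `∇f(y*) = H̄y* + b = 0`), and
`x̄⁺ = ȳ − (1/n)∑ (Hᵢ + μI)⁻¹ ∇f(ȳ)` where `∇f(ȳ) = H̄ȳ + b`, one has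
`‖x̄⁺ − y*‖ ≤ θ₁ ‖ȳ − y*‖`. -/
theorem dane_one_step_contraction
    {n d : ℕ} (hn : 0 < n) (σ L μ β θ₁ : ℝ)
    (hσ : 0 < σ) (hσL : σ ≤ L) (hμ : 0 ≤ μ)
    (H : Fin n → Matrix (Fin d) (Fin d) ℝ)
    (hsymm : ∀ i, (H i).IsSymm)
    (hlow : ∀ i, (H i - σ • (1 : Matrix (Fin d) (Fin d) ℝ)).PosSemidef)
    (hup : ∀ i, (L • (1 : Matrix (Fin d) (Fin d) ℝ) - H i).PosSemidef)
    (Hbar : Matrix (Fin d) (Fin d) ℝ) (hHbar : Hbar = (n : ℝ)⁻¹ • ∑ i, H i)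
    (hβ : IsGreatest (Set.range fun i => specNorm (H i - Hbar)) β)
    (hβμ : β < σ + μ)
    (b : Fin d → ℝ) (c : ℝ)
    (ystar : Fin d → ℝ) (hstar : Hbar.mulVec ystar + b = 0)
    (ybar xplus : Fin d → ℝ)
    (hxplus : xplus = ybar
      - ((n : ℝ)⁻¹ • ∑ i, (H i + μ • 1)⁻¹).mulVec (Hbar.mulVec ybar + b))
    (hθ : θ₁ = 1 - σ / (σ + μ) + L / (L + μ) * (β ^ 2 / ((σ + μ) * (σ + μ - β)))) :
    vecNorm (xplus - ystar) ≤ θ₁ * vecNorm (ybar - ystar) := by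
  have hβ₀ : 0 ≤ β := by
    obtain ⟨i, rfl⟩ := hβ.1
    exact norm_nonneg _
  have hL : 0 < L := hσ.trans_le hσL
  have hs : 0 < σ + μ := by positivity
  have hcontr := norm_one_sub_average_inv_mul_le hn hσ hL hμ hβ₀ hlow hup hHbar
    fun i => hβ.2 ⟨i, rfl⟩
  have hstep : xplus - ystar =
      (1 - ((n : ℝ)⁻¹ • ∑ i, (H i + μ • 1)⁻¹) * Hbar).mulVec (ybar - ystar) := by
    rw [hxplus, eq_neg_of_add_eq_zero_right hstar, ← sub_eq_add_neg, ← mulVec_sub, sub_mulVec,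
      one_mulVec, mulVec_mulVec]
    abel
  rw [hstep]
  refine (vecNorm_mulVec_le _ _).trans (mul_le_mul_of_nonneg_right ?_ (Real.sqrt_nonneg _))
  refine hcontr.trans ?_
  have hμσ : 1 - σ / (σ + μ) = μ / (σ + μ) := by
    field_simp
    ring
  rw [hθ, hμσ, sq (σ + μ)]
  have hpos : 0 < σ + μ - β := sub_pos.2 hβμ
  gcongr
  exact sub_le_self _ hβ₀

end
end
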